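/- Suppose J has mean ∫ z dJ(z) = 1 and is absolutely continuous with a density bounded away from 0 on every compact subset of [0,∞). For each k let f^{(k)} be a mean-field model and let f be a mean-field model, and suppose the initial CDFs converge weakly: f^{(k)}_·(0) → f_·(0) weakly as k → ∞. Then the solutions depend continuously on the initial condition: for every T > 0, sup_{t ∈ [0,T]} d_LP(μ^{(k)}_t, μ_t) → 0 as k → ∞, where μ^{(k)}_t and μ_t are the probability measures on ℝ with CDFs f^{(k)}_·(t) and f_·(t), and d_LP is the Lévy–Prokhorov distance (metrizing weak convergence). -/

import Mathlib

open MeasureTheory Filter Set ENNReal NNReal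

noncomputable section

/-- sign: `1` if `0 ≤ y`, `-1` otherwise. -/
def sgn (y : ℝ) : ℝ := if 0 ≤ y then 1 else -1

/-- `F` is a (proper) cumulative distribution function. -/
structure IsCDF (F : ℝ → ℝ) : Prop where
  mono : Monotone F
  right_continuous : ∀ x, ContinuousWithinAt F (Set.Ici x) x
  tendsto_atBot : Filter.Tendsto F Filter.atBot (nhds 0)
  tendsto_atTop : Filter.Tendsto F Filter.atTop (nhds 1)

open Classical in
/-- The Lebesgue–Stieltjes measure associated with `F` (junk value `0` if `F` is not
monotone right-continuous). -/
noncomputable def cdfMeasure (F : ℝ → ℝ) : Measure ℝ :=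
  if h : Monotone F ∧ ∀ x, ContinuousWithinAt F (Set.Ici x) x then
    StieltjesFunction.measure ⟨F, h.1, h.2⟩
  else 0

/-- Quantile (generalized inverse) of `F`. -/
noncomputable def quantile (F : ℝ → ℝ) (ν : ℝ) : ℝ := sInf {y | ν ≤ F y}

/-- Complementary CDF of the jump-size distribution `J`. -/
noncomputable def Jbar (J : Measure ℝ) (u : ℝ) : ℝ := (J (Set.Ioi u)).toReal

/-- Right-hand side of the mean-field-model equation (with the minus sign). -/
noncomputable def mfmRHS (η : ℝ → ℝ) (J : Measure ℝ) (F : ℝ → ℝ) (x : ℝ) : ℝ :=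
  -∫ ν in Set.Ioo (0:ℝ) 1,
      η ν * (if quantile F ν ≤ x then Jbar J (x - quantile F ν) else 0)

/-- Mean-field model: (a) each `f ⬝ t` is a CDF; (b) `t ↦ f x t` is nonincreasing and
Lipschitz with constant independent of `x`; (c) wherever the `t`-derivative exists it
equals the mean-field right-hand side. -/
def IsMFM (η : ℝ → ℝ) (J : Measure ℝ) (f : ℝ → ℝ → ℝ) : Prop :=
  (∀ t : ℝ, 0 ≤ t → IsCDF (fun x => f x t)) ∧
  (∀ x : ℝ, AntitoneOn (f x) (Set.Ici 0)) ∧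
  (∃ c : NNReal, ∀ x : ℝ, LipschitzOnWith c (f x) (Set.Ici 0)) ∧
  (∀ x t : ℝ, 0 ≤ t → ∀ d : ℝ,
    HasDerivWithinAt (f x) d (Set.Ici 0) t → d = mfmRHS η J (fun y => f y t) x)

/-- The nondecreasing rearrangement of a finite tuple. -/
noncomputable def sortVec {n : ℕ} (w : Fin n → ℝ) : Fin n → ℝ := fun i => w (Tuple.sort w i)

/-- Outcome of one jump urge: `p = (ℓ, u, z)`; if `u ≤ η_n ℓ` the rank-`ℓ` particle jumps by
`z`, everything is recentered by `z/n` and sorted; otherwise nothing happens. -/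
noncomputable def jumpOutcome (n : ℕ) (ηn : Fin n → ℝ) (w : Fin n → ℝ)
    (p : Fin n × ℝ × ℝ) : Fin n → ℝ :=
  if p.2.1 ≤ ηn p.1 then
    sortVec (fun i => w i + (if i = p.1 then p.2.2 else 0) - p.2.2 / n)
  else w

/-- The Markov transition kernel of the embedded (centered) jump chain: `ℓ` uniform on
`Fin n`, `u` uniform on `[0,1]`, `z ∼ J`, independent. -/
noncomputable def Kn (n : ℕ) (ηn : Fin n → ℝ) (J : Measure ℝ) (w : Fin n → ℝ) :
    Measure (Fin n → ℝ) :=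
  Measure.map (jumpOutcome n ηn w)
    ((((n : ℝ≥0∞))⁻¹ • (Measure.count : Measure (Fin n))).prod
      ((MeasureTheory.volume.restrict (Set.Icc (0:ℝ) 1)).prod J))

/-- The state space: nondecreasing, centered configurations. -/
def Wset (n : ℕ) : Set (Fin n → ℝ) := {w | Monotone w ∧ ∑ i, w i = 0}

/-- `p`-th absolute empirical moment. -/
noncomputable def Phi (n : ℕ) (p : ℝ) (w : Fin n → ℝ) : ℝ :=
  (1 / n) * ∑ i, |w i| ^ p

/-- The drift functional `G_n`. -/
noncomputable def Gn (n : ℕ) (χ : ℝ) (ηn : Fin n → ℝ) (w : Fin n → ℝ) : ℝ :=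
  (2 + χ) * ((1 / n) * ∑ i, (ηn i - (1 / n) * ∑ ℓ, ηn ℓ) * sgn (w i) * |w i| ^ (1 + χ))

/-- Empirical CDF of the configuration `w`. -/
noncomputable def empCDF (n : ℕ) (w : Fin n → ℝ) (x : ℝ) : ℝ :=
  (1 / n) * (Finset.univ.filter (fun i => w i ≤ x)).card

/-- `J` is absolutely continuous with a density bounded away from `0` on every compact
subset of `[0, ∞)`. -/
def DensityLowerBdd (J : Measure ℝ) : Prop :=
  ∃ g : ℝ → ℝ≥0∞, J = MeasureTheory.volume.withDensity g ∧
    ∀ b : ℝ, 0 < b → ∃ c : ℝ≥0∞, 0 < c ∧ ∀ x ∈ Set.Icc (0:ℝ) b, c ≤ g x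

/-- The test-function class `C_b`: bounded continuous functions that are constant near
`-∞` and near `+∞`. -/
def CbTail (h : ℝ → ℝ) : Prop :=
  Continuous h ∧ (∃ M : ℝ, ∀ x, |h x| ≤ M) ∧
    ∃ a b : ℝ, a ≤ b ∧ (∀ x ≤ a, h x = h a) ∧ (∀ x, b ≤ x → h x = h b)

/-- The generator-type operator `L[F]h`. -/
noncomputable def Lop (η : ℝ → ℝ) (J : Measure ℝ) (F : ℝ → ℝ) (h : ℝ → ℝ) : ℝ :=
  ∫ ν in Set.Ioo (0:ℝ) 1, η ν * ∫ z, (h (quantile F ν + z) - h (quantile F ν)) ∂J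

end
open Topology

section Quantile

variable {F G : ℝ → ℝ}

lemma IsCDF.nonneg (hF : IsCDF F) (x : ℝ) : 0 ≤ F x :=
  hF.mono.le_of_tendsto hF.tendsto_atBot x

lemma IsCDF.le_one (hF : IsCDF F) (x : ℝ) : F x ≤ 1 :=
  hF.mono.ge_of_tendsto hF.tendsto_atTop x

lemma IsCDF.mem_Icc (hF : IsCDF F) (x : ℝ) : F x ∈ Icc (0 : ℝ) 1 :=
  ⟨hF.nonneg x, hF.le_one x⟩

lemma IsCDF.quantile_le_iff (hF : IsCDF F) {ν : ℝ} (hν : ν ∈ Ioo (0 : ℝ) 1) (x : ℝ) :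
    quantile F ν ≤ x ↔ ν ≤ F x := by
  have hne : {y | ν ≤ F y}.Nonempty :=
    ((hF.tendsto_atTop.eventually (lt_mem_nhds hν.2)).mono fun _ h => h.le).exists
  have hbdd : BddBelow {y | ν ≤ F y} := by
    obtain ⟨b, hb⟩ := (hF.tendsto_atBot.eventually (gt_mem_nhds hν.1)).exists
    exact ⟨b, fun y hy => (hF.mono.reflect_lt (hb.trans_le hy)).le⟩
  refine ⟨fun h => ?_, fun h => csInf_le hbdd h⟩
  have hmem : ν ≤ F (quantile F ν) := by
    have ht : Tendsto F (𝓝[>] (quantile F ν)) (𝓝 (F (quantile F ν))) :=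
      (hF.right_continuous _).mono Ioi_subset_Ici_self
    refine ge_of_tendsto ht ?_
    filter_upwards [self_mem_nhdsWithin] with y hy
    obtain ⟨w, hw, hwy⟩ := exists_lt_of_csInf_lt hne hy
    exact hw.trans (hF.mono hwy.le)
  exact hmem.trans (hF.mono h)

lemma IsCDF.lt_quantile_iff (hF : IsCDF F) {ν : ℝ} (hν : ν ∈ Ioo (0 : ℝ) 1) (x : ℝ) :
    x < quantile F ν ↔ F x < ν := by
  rw [← not_le, hF.quantile_le_iff hν, not_le]

lemma IsCDF.aemeasurable_quantile (hF : IsCDF F) :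
    AEMeasurable (quantile F) (volume.restrict (Ioo (0 : ℝ) 1)) := by
  refine aemeasurable_restrict_of_monotoneOn measurableSet_Ioo fun a ha b hb hab => ?_
  rw [hF.quantile_le_iff ha]
  exact hab.trans ((hF.quantile_le_iff hb _).1 le_rfl)

lemma IsCDF.cdfMeasure_Iic (hF : IsCDF F) (x : ℝ) :
    cdfMeasure F (Iic x) = ENNReal.ofReal (F x) := by
  rw [cdfMeasure, dif_pos ⟨hF.mono, hF.right_continuous⟩,
    StieltjesFunction.measure_Iic _ hF.tendsto_atBot, sub_zero]

lemma IsCDF.isProbabilityMeasure (hF : IsCDF F) : IsProbabilityMeasure (cdfMeasure F) := by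
  rw [cdfMeasure, dif_pos ⟨hF.mono, hF.right_continuous⟩]
  exact StieltjesFunction.isProbabilityMeasure _ hF.tendsto_atBot hF.tendsto_atTop

lemma IsCDF.map_quantile (hF : IsCDF F) :
    (volume.restrict (Ioo (0 : ℝ) 1)).map (quantile F) = cdfMeasure F := by
  have := hF.isProbabilityMeasure
  refine Measure.ext_of_Iic _ _ fun x => ?_
  rw [Measure.map_apply_of_aemeasurable hF.aemeasurable_quantile measurableSet_Iic,
    hF.cdfMeasure_Iic, Measure.restrict_apply₀
      (hF.aemeasurable_quantile.nullMeasurableSet_preimage measurableSet_Iic)]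
  have : quantile F ⁻¹' Iic x ∩ Ioo 0 1 = Ioc 0 (F x) ∩ Ioo 0 1 := by
    ext ν
    simp only [mem_inter_iff, mem_preimage, mem_Iic, mem_Ioc]
    refine and_congr_left fun hν => ?_
    rw [hF.quantile_le_iff hν]
    exact ⟨fun h => ⟨hν.1, h⟩, fun h => h.2⟩
  rw [this, ← Measure.restrict_apply measurableSet_Ioc, Measure.restrict_congr_set Ioo_ae_eq_Ioc,
    Measure.restrict_apply measurableSet_Ioc, inter_eq_left.2
      (Ioc_subset_Ioc_right (hF.le_one x)), Real.volume_Ioc, sub_zero]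

/-- Bound on the Lévy–Prokhorov distance from the quantile coupling. -/
lemma levyProkhorovDist_le_of_quantile (hF : IsCDF F) (hG : IsCDF G) {r : ℝ} (hr : 0 ≤ r)
    (h : volume {ν ∈ Ioo (0 : ℝ) 1 | r < |quantile F ν - quantile G ν|} ≤ ENNReal.ofReal r) :
    levyProkhorovDist (cdfMeasure F) (cdfMeasure G) ≤ r := by
  have := hF.isProbabilityMeasure
  have := hG.isProbabilityMeasure
  refine levyProkhorovDist_le_of_forall_le _ _ hr fun ε B hε hB => ?_
  have hT : MeasurableSet (Metric.thickening ε B) := Metric.isOpen_thickening.measurableSet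
  rw [← hF.map_quantile, ← hG.map_quantile,
    Measure.map_apply_of_aemeasurable hF.aemeasurable_quantile hB,
    Measure.map_apply_of_aemeasurable hG.aemeasurable_quantile hT]
  set μ := volume.restrict (Ioo (0 : ℝ) 1)
  have hbad : μ {ν | r < |quantile F ν - quantile G ν|} ≤ ENNReal.ofReal ε := by
    rw [Measure.restrict_apply' measurableSet_Ioo, inter_comm]
    exact h.trans (ENNReal.ofReal_le_ofReal hε.le)
  refine (measure_mono fun ν hν => ?_).trans ((measure_union_le _ _).trans
    (add_le_add_right hbad _))
  by_cases hr' : r < |quantile F ν - quantile G ν|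
  · exact Or.inr hr'
  · refine Or.inl (Metric.mem_thickening_iff.2 ⟨quantile F ν, hν, ?_⟩)
    rw [Real.dist_eq, abs_sub_comm]
    exact (not_lt.1 hr').trans_lt hε

/-- Two CDFs that are close in the Lévy distance are close in the Lévy–Prokhorov distance,
with a bound depending only on the tails of one of them. -/
lemma levyProkhorovDist_le_of_levy (hF : IsCDF F) (hG : IsCDF G) {a h κ δ r : ℝ} {N : ℕ}
    (hh : 0 ≤ h) (hδ : 0 ≤ δ) (hκ : 0 ≤ κ)
    (hleft : G a ≤ κ) (hright : 1 - κ ≤ G (a + N * h))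
    (hFG : ∀ x, F x ≤ G (x + δ) + δ) (hGF : ∀ x, G x ≤ F (x + δ) + δ)
    (hr₁ : h + δ ≤ r) (hr₂ : 2 * κ + 2 * (N + 1) * δ ≤ r) :
    levyProkhorovDist (cdfMeasure F) (cdfMeasure G) ≤ r := by
  refine levyProkhorovDist_le_of_quantile hF hG (by linarith) ?_
  have hsub : {ν ∈ Ioo (0 : ℝ) 1 | r < |quantile F ν - quantile G ν|} ⊆
      (Icc 0 κ ∪ Icc (1 - κ) 1) ∪
        ⋃ i ∈ Finset.range (N + 1), Icc (G (a + i * h) - δ) (G (a + i * h) + δ) := by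
    rintro ν ⟨hν, hbad⟩
    by_cases h0 : ν ≤ G a
    · exact Or.inl (Or.inl ⟨hν.1.le, h0.trans hleft⟩)
    by_cases hN : G (a + N * h) < ν
    · exact Or.inl (Or.inr ⟨hright.trans hN.le, hν.2.le⟩)
    right
    have hex : ∃ n : ℕ, ν ≤ G (a + n * h) := ⟨N, not_lt.1 hN⟩
    classical
    obtain ⟨n, hn, hmin⟩ : ∃ n : ℕ, ν ≤ G (a + n * h) ∧ ∀ m < n, ¬ ν ≤ G (a + m * h) :=
      ⟨Nat.find hex, Nat.find_spec hex, fun m hm => Nat.find_min hex hm⟩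
    have hnN : n ≤ N := by
      by_contra! hlt
      exact hmin N hlt (not_lt.1 hN)
    obtain ⟨m, rfl⟩ : ∃ m, n = m + 1 := by
      refine Nat.exists_eq_succ_of_ne_zero fun h0' => h0 ?_
      simpa [h0'] using hn
    have hm := not_le.1 (hmin m (Nat.lt_succ_self m))
    simp only [mem_iUnion, Finset.mem_range, exists_prop]
    have hqle := (hG.quantile_le_iff hν _).2 hn
    have hltq := (hG.lt_quantile_iff hν _).2 hm
    push_cast at hqle
    rcases lt_abs.1 hbad with hb | hb
    · refine ⟨m + 1, by omega, ?_, by linarith⟩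
      have : F (a + (m + 1 : ℕ) * h + δ) < ν := by
        rw [← hF.lt_quantile_iff hν]
        push_cast
        linarith
      linarith [hGF (a + (m + 1 : ℕ) * h)]
    · refine ⟨m, by omega, by linarith, ?_⟩
      have : ν ≤ F (a + m * h - δ) := by
        rw [← hF.quantile_le_iff hν]
        linarith
      have h2 := hFG (a + m * h - δ)
      rw [sub_add_cancel] at h2
      linarith
  refine (measure_mono hsub).trans ((measure_union_le _ _).trans ?_)
  have h1 : volume (Icc 0 κ ∪ Icc (1 - κ) 1) ≤ ENNReal.ofReal (2 * κ) := by
    refine (measure_union_le _ _).trans ?_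
    rw [Real.volume_Icc, Real.volume_Icc, ← ENNReal.ofReal_add (by linarith) (by linarith)]
    exact ENNReal.ofReal_le_ofReal (by linarith)
  have h2 : volume (⋃ i ∈ Finset.range (N + 1), Icc (G (a + i * h) - δ) (G (a + i * h) + δ)) ≤
      ENNReal.ofReal (2 * (N + 1) * δ) := by
    refine (measure_biUnion_finset_le _ _).trans ?_
    simp only [Real.volume_Icc]
    rw [← ENNReal.ofReal_sum_of_nonneg (fun i _ => by linarith)]
    refine ENNReal.ofReal_le_ofReal (le_of_eq ?_)
    simp only [add_sub_sub_cancel, Finset.sum_const, Finset.card_range, nsmul_eq_mul]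
    push_cast
    ring
  calc _ ≤ ENNReal.ofReal (2 * κ) + ENNReal.ofReal (2 * (N + 1) * δ) := add_le_add h1 h2
    _ = ENNReal.ofReal (2 * κ + 2 * (N + 1) * δ) :=
      (ENNReal.ofReal_add (by positivity) (by positivity)).symm
    _ ≤ _ := ENNReal.ofReal_le_ofReal hr₂

/-- Weak convergence implies convergence in the Lévy distance. -/
lemma eventually_levy_of_weak {Fk : ℕ → ℝ → ℝ} (hFk : ∀ k, IsCDF (Fk k)) (hF : IsCDF F)
    (hweak : ∀ h : BoundedContinuousFunction ℝ ℝ,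
      Tendsto (fun k => ∫ x, h x ∂(cdfMeasure (Fk k))) atTop (𝓝 (∫ x, h x ∂(cdfMeasure F))))
    {δ : ℝ} (hδ : 0 < δ) :
    ∀ᶠ k in atTop, (∀ x, Fk k x ≤ F (x + δ) + δ) ∧ ∀ x, F x ≤ Fk k (x + δ) + δ := by
  let P : ℕ → ProbabilityMeasure ℝ := fun k => ⟨cdfMeasure (Fk k), (hFk k).isProbabilityMeasure⟩
  let Q : ProbabilityMeasure ℝ := ⟨cdfMeasure F, hF.isProbabilityMeasure⟩
  have hPQ : Tendsto P atTop (𝓝 Q) :=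
    ProbabilityMeasure.tendsto_iff_forall_integral_tendsto.2 hweak
  have hLP := ((LevyProkhorov.probabilityMeasureHomeomorph (Ω := ℝ)).continuous.tendsto Q).comp hPQ
  have hev := EMetric.tendsto_nhds.1 hLP (ENNReal.ofReal δ) (ENNReal.ofReal_pos.2 hδ)
  have key : ∀ {A B : ℝ → ℝ}, IsCDF A → IsCDF B → (∀ x, cdfMeasure A (Iic x) ≤
      cdfMeasure B (Metric.thickening (ENNReal.ofReal δ).toReal (Iic x)) + ENNReal.ofReal δ) →
      ∀ x, A x ≤ B (x + δ) + δ := by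
    intro A B hA hB h x
    have hsub : Metric.thickening (ENNReal.ofReal δ).toReal (Iic x) ⊆ Iic (x + δ) := by
      intro y hy
      rw [ENNReal.toReal_ofReal hδ.le] at hy
      obtain ⟨z, hz, hyz⟩ := Metric.mem_thickening_iff.1 hy
      rw [Real.dist_eq] at hyz
      have := (abs_lt.1 hyz).2
      simp only [mem_Iic] at hz ⊢
      linarith
    have h' := (h x).trans (add_le_add_left (measure_mono hsub) _)
    rw [hA.cdfMeasure_Iic, hB.cdfMeasure_Iic, ← ENNReal.ofReal_add (hB.nonneg _) hδ.le] at h'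
    exact (ENNReal.ofReal_le_ofReal_iff (add_nonneg (hB.nonneg _) hδ.le)).1 h'
  filter_upwards [hev] with k hk
  have hk' : levyProkhorovEDist (cdfMeasure (Fk k)) (cdfMeasure F) < ENNReal.ofReal δ := hk
  exact ⟨key (hFk k) hF fun x => left_measure_le_of_levyProkhorovEDist_lt hk' measurableSet_Iic,
    key hF (hFk k) fun x => right_measure_le_of_levyProkhorovEDist_lt hk' measurableSet_Iic⟩

end Quantile

section Comparison

variable {η : ℝ → ℝ} {J : Measure ℝ} {F G : ℝ → ℝ}

/-- The primitive of the jump rate `η` vanishing at `0`. -/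
noncomputable def rateIntegral (η : ℝ → ℝ) (u : ℝ) : ℝ := ∫ ν in (0 : ℝ)..u, η ν

lemma intervalIntegrable_rate (hc : ContinuousOn η (Icc 0 1)) {a b : ℝ}
    (ha : a ∈ Icc (0 : ℝ) 1) (hb : b ∈ Icc (0 : ℝ) 1) : IntervalIntegrable η volume a b :=
  (hc.mono (uIcc_subset_Icc ha hb)).intervalIntegrable

lemma rateIntegral_sub (hc : ContinuousOn η (Icc 0 1)) {a b : ℝ}
    (ha : a ∈ Icc (0 : ℝ) 1) (hb : b ∈ Icc (0 : ℝ) 1) :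
    rateIntegral η b - rateIntegral η a = ∫ ν in a..b, η ν :=
  intervalIntegral.integral_interval_sub_left
    (intervalIntegrable_rate hc (left_mem_Icc.2 zero_le_one) hb)
    (intervalIntegrable_rate hc (left_mem_Icc.2 zero_le_one) ha)

lemma rateIntegral_sub_mem_Icc (hc : ContinuousOn η (Icc 0 1))
    (hη : ∀ ν ∈ Icc (0 : ℝ) 1, η ν ∈ Icc (0 : ℝ) 1) {a b : ℝ}
    (ha : a ∈ Icc (0 : ℝ) 1) (hb : b ∈ Icc (0 : ℝ) 1) (hab : a ≤ b) :
    rateIntegral η b - rateIntegral η a ∈ Icc 0 (b - a) := by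
  rw [rateIntegral_sub hc ha hb]
  have hsub : ∀ ν ∈ Icc a b, ν ∈ Icc (0 : ℝ) 1 := fun ν h => ⟨ha.1.trans h.1, h.2.trans hb.2⟩
  refine ⟨intervalIntegral.integral_nonneg hab fun ν h => (hη ν (hsub ν h)).1, ?_⟩
  calc ∫ ν in a..b, η ν ≤ ∫ _ in a..b, (1 : ℝ) :=
        intervalIntegral.integral_mono_on hab (intervalIntegrable_rate hc ha hb)
          intervalIntegrable_const fun ν h => (hη ν (hsub ν h)).2
    _ = b - a := by simp

lemma rateIntegral_mem_Icc (hc : ContinuousOn η (Icc 0 1))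
    (hη : ∀ ν ∈ Icc (0 : ℝ) 1, η ν ∈ Icc (0 : ℝ) 1) {a : ℝ} (ha : a ∈ Icc (0 : ℝ) 1) :
    rateIntegral η a ∈ Icc (0 : ℝ) 1 := by
  have h := rateIntegral_sub_mem_Icc hc hη (left_mem_Icc.2 zero_le_one) ha ha.1
  have h0 : rateIntegral η 0 = 0 := intervalIntegral.integral_same
  rw [h0, sub_zero, sub_zero] at h
  exact ⟨h.1, h.2.trans ha.2⟩

lemma IsCDF.integrable_rateIntegral (hF : IsCDF F) [IsFiniteMeasure J]
    (hc : ContinuousOn η (Icc 0 1)) (hη : ∀ ν ∈ Icc (0 : ℝ) 1, η ν ∈ Icc (0 : ℝ) 1) (x : ℝ) :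
    Integrable (fun z => rateIntegral η (F (x - z))) J := by
  have hanti : Antitone fun z => rateIntegral η (F (x - z)) := fun a b hab =>
    sub_nonneg.1 (rateIntegral_sub_mem_Icc hc hη (hF.mem_Icc _) (hF.mem_Icc _)
      (hF.mono (by linarith))).1
  refine Integrable.of_bound hanti.measurable.aestronglyMeasurable 1 (ae_of_all _ fun z => ?_)
  have := rateIntegral_mem_Icc hc hη (hF.mem_Icc (x - z))
  rw [Real.norm_eq_abs, abs_le]
  exact ⟨by linarith [this.1], this.2⟩

/-- The right-hand side of the mean-field equation as a convolution with `J`. -/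
lemma IsCDF.mfmRHS_eq (hF : IsCDF F) [IsProbabilityMeasure J] (hJ0 : J (Iic 0) = 0)
    (hc : ContinuousOn η (Icc 0 1)) (hη : ∀ ν ∈ Icc (0 : ℝ) 1, η ν ∈ Icc (0 : ℝ) 1) (x : ℝ) :
    mfmRHS η J F x = ∫ z, rateIntegral η (F (x - z)) ∂J - rateIntegral η (F x) := by
  set μ := volume.restrict (Ioo (0 : ℝ) 1)
  have hset : ∀ ν ∈ Ioo (0 : ℝ) 1,
      η ν * (if quantile F ν ≤ x then Jbar J (x - quantile F ν) else 0) =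
        ∫ z, (if F (x - z) < ν ∧ ν ≤ F x then η ν else 0) ∂J := by
    intro ν hν
    by_cases hq : quantile F ν ≤ x
    · have hx := (hF.quantile_le_iff hν x).1 hq
      have hfun : (fun z => if F (x - z) < ν ∧ ν ≤ F x then η ν else 0) =
          (Ioi (x - quantile F ν)).indicator fun _ => η ν := by
        ext z
        simp only [hx, and_true, indicator_apply, mem_Ioi, ← hF.lt_quantile_iff hν]
        congr 1
        rw [eq_iff_iff]
        constructor <;> intro h <;> linarith
      rw [hfun, integral_indicator measurableSet_Ioi, if_pos hq, setIntegral_const, Jbar,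
        smul_eq_mul, mul_comm, Measure.real]
    · have hx : ¬ ν ≤ F x := fun h => hq ((hF.quantile_le_iff hν x).2 h)
      simp [hq, hx]
  have hmeas : AEStronglyMeasurable
      (fun p : ℝ × ℝ => if F (x - p.2) < p.1 ∧ p.1 ≤ F x then η p.1 else 0) (μ.prod J) := by
    have h1 : AEStronglyMeasurable (fun p : ℝ × ℝ => η p.1) (μ.prod J) :=
      ((hc.mono Ioo_subset_Icc_self).aestronglyMeasurable measurableSet_Ioo).comp_fst
    have hs : MeasurableSet {p : ℝ × ℝ | F (x - p.2) < p.1 ∧ p.1 ≤ F x} := by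
      refine (measurableSet_lt ?_ measurable_fst).inter
        (measurableSet_le measurable_fst measurable_const)
      exact hF.mono.measurable.comp (measurable_const.sub measurable_snd)
    refine (h1.indicator hs).congr (ae_of_all _ fun p => ?_)
    simp [indicator_apply]
  have hint : Integrable
      (fun p : ℝ × ℝ => if F (x - p.2) < p.1 ∧ p.1 ≤ F x then η p.1 else 0) (μ.prod J) := by
    refine Integrable.of_bound hmeas 1 ?_
    have hμ : ∀ᵐ ν ∂μ, ν ∈ Ioo (0 : ℝ) 1 := ae_restrict_mem measurableSet_Ioo
    filter_upwards [Measure.quasiMeasurePreserving_fst.ae hμ] with p hp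
    have := hη p.1 (Ioo_subset_Icc_self hp)
    split_ifs
    · rw [Real.norm_eq_abs, abs_of_nonneg this.1]
      exact this.2
    · simp
  have hJpos : ∀ᵐ z ∂J, 0 < z := by
    rw [ae_iff]
    simp only [not_lt]
    exact hJ0
  have hinner : ∀ z, 0 < z → ∫ ν, (if F (x - z) < ν ∧ ν ≤ F x then η ν else 0) ∂μ =
      rateIntegral η (F x) - rateIntegral η (F (x - z)) := by
    intro z hz
    have hle : F (x - z) ≤ F x := hF.mono (by linarith)
    have hfun : (fun ν => if F (x - z) < ν ∧ ν ≤ F x then η ν else 0) =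
        (Ioc (F (x - z)) (F x)).indicator η := by
      ext ν
      simp [indicator_apply]
    rw [rateIntegral_sub hc (hF.mem_Icc _) (hF.mem_Icc _),
      intervalIntegral.integral_of_le hle, hfun, integral_indicator measurableSet_Ioc,
      show μ = volume.restrict (Ioc 0 1) from Measure.restrict_congr_set Ioo_ae_eq_Ioc,
      Measure.restrict_restrict measurableSet_Ioc,
      inter_eq_left.2 (Ioc_subset_Ioc (hF.nonneg _) (hF.le_one _))]
  rw [mfmRHS, setIntegral_congr_fun measurableSet_Ioo hset, integral_integral_swap hint,
    integral_congr_ae (hJpos.mono hinner), integral_sub (integrable_const _)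
      (hF.integrable_rateIntegral hc hη x), integral_const]
  simp

/-- One-sided Lipschitz estimate for the right-hand side of the mean-field equation. -/
lemma IsCDF.add_mfmRHS_sub_le (hF : IsCDF F) (hG : IsCDF G) [IsProbabilityMeasure J]
    (hJ0 : J (Iic 0) = 0)
    (hc : ContinuousOn η (Icc 0 1)) (hη : ∀ ν ∈ Icc (0 : ℝ) 1, η ν ∈ Icc (0 : ℝ) 1)
    {δ S : ℝ} (hS : 0 ≤ S) (hFG : ∀ y, F y - G (y + δ) ≤ S) (x : ℝ) :
    F x - G (x + δ) + (mfmRHS η J F x - mfmRHS η J G (x + δ)) ≤ 2 * S := by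
  have hle : ∀ y, rateIntegral η (F y) - rateIntegral η (G (y + δ)) ≤ S := by
    intro y
    rcases le_total (F y) (G (y + δ)) with h | h
    · linarith [(rateIntegral_sub_mem_Icc hc hη (hF.mem_Icc _) (hG.mem_Icc _) h).1]
    · linarith [(rateIntegral_sub_mem_Icc hc hη (hG.mem_Icc _) (hF.mem_Icc _) h).2, hFG y]
  have hle' : F x - rateIntegral η (F x) - (G (x + δ) - rateIntegral η (G (x + δ))) ≤ S := by
    rcases le_total (F x) (G (x + δ)) with h | h
    · linarith [(rateIntegral_sub_mem_Icc hc hη (hF.mem_Icc _) (hG.mem_Icc _) h).2]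
    · linarith [(rateIntegral_sub_mem_Icc hc hη (hG.mem_Icc _) (hF.mem_Icc _) h).1, hFG x]
  have hint : ∫ z, rateIntegral η (F (x - z)) ∂J - ∫ z, rateIntegral η (G (x + δ - z)) ∂J ≤ S := by
    rw [← integral_sub (hF.integrable_rateIntegral hc hη x)
      (hG.integrable_rateIntegral hc hη (x + δ))]
    calc _ ≤ ∫ _, S ∂J := integral_mono ((hF.integrable_rateIntegral hc hη x).sub
            (hG.integrable_rateIntegral hc hη (x + δ))) (integrable_const S) fun z => by
              have := hle (x - z)
              rwa [show x - z + δ = x + δ - z by ring] at this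
      _ = S := by simp
  rw [hF.mfmRHS_eq hJ0 hc hη, hG.mfmRHS_eq hJ0 hc hη]
  linarith

variable {f g : ℝ → ℝ → ℝ}

lemma AbsolutelyContinuousOnInterval.le_of_ae_deriv_nonpos {φ : ℝ → ℝ} {a b : ℝ} (hab : a ≤ b)
    (hφ : AbsolutelyContinuousOnInterval φ a b)
    (h : ∀ᵐ t, t ∈ Ioo a b → deriv φ t ≤ 0) : φ b ≤ φ a := by
  rw [← sub_nonpos, ← hφ.integral_deriv_eq_sub, intervalIntegral.integral_of_le hab,
    integral_Ioc_eq_integral_Ioo]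
  exact setIntegral_nonpos_ae measurableSet_Ioo h

/-- One step of the Gronwall iteration: a bound on the one-sided distance is improved. -/
lemma IsMFM.sub_le_of_sub_le [IsProbabilityMeasure J] (hJ0 : J (Iic 0) = 0)
    (hc : ContinuousOn η (Icc 0 1)) (hη : ∀ ν ∈ Icc (0 : ℝ) 1, η ν ∈ Icc (0 : ℝ) 1)
    (hf : IsMFM η J f) (hg : IsMFM η J g) {δ ε S : ℝ} (hε : 0 ≤ ε) (hS : 0 ≤ S)
    (h0 : ∀ x, f x 0 - g (x + δ) 0 ≤ ε)
    (h : ∀ x t, 0 ≤ t → f x t - g (x + δ) t ≤ S * Real.exp (2 * t)) (x t : ℝ) (ht : 0 ≤ t) :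
    f x t - g (x + δ) t ≤ (ε + 2 / 3 * S) * Real.exp (2 * t) := by
  obtain ⟨hf₁, -, ⟨cf, hf₃⟩, hf₄⟩ := hf
  obtain ⟨hg₁, -, ⟨cg, hg₃⟩, hg₄⟩ := hg
  have hsub : uIcc 0 t ⊆ Ici 0 := by
    rw [uIcc_of_le ht]
    exact Icc_subset_Ici_self
  have hfac : AbsolutelyContinuousOnInterval (f x) 0 t :=
    ((hf₃ x).mono hsub).absolutelyContinuousOnInterval
  have hgac : AbsolutelyContinuousOnInterval (g (x + δ)) 0 t :=
    ((hg₃ (x + δ)).mono hsub).absolutelyContinuousOnInterval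
  have hexp : ∀ c : ℝ, AbsolutelyContinuousOnInterval (fun s => Real.exp (c * s)) 0 t := by
    intro c
    refine ContDiffOn.absolutelyContinuousOnInterval (ContDiff.contDiffOn ?_)
    fun_prop
  let φ : ℝ → ℝ := fun s => Real.exp (1 * s) * (f x s - g (x + δ) s) -
    2 / 3 * S * Real.exp (3 * s)
  have hφ : AbsolutelyContinuousOnInterval φ 0 t :=
    ((hexp 1).mul (hfac.sub hgac)).sub ((hexp 3).const_mul (2 / 3 * S))
  have hmain : φ t ≤ φ 0 := by
    refine hφ.le_of_ae_deriv_nonpos ht ?_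
    filter_upwards [hfac.ae_differentiableAt, hgac.ae_differentiableAt] with s hfs hgs hs
    have hs' : s ∈ uIcc 0 t := by
      rw [uIcc_of_le ht]
      exact Ioo_subset_Icc_self hs
    have hs0 : 0 ≤ s := hs.1.le
    have hfd := (hfs hs').hasDerivAt
    have hgd := (hgs hs').hasDerivAt
    have hfe := hf₄ x s hs0 _ hfd.hasDerivWithinAt
    have hge := hg₄ (x + δ) s hs0 _ hgd.hasDerivWithinAt
    rw [hfe] at hfd
    rw [hge] at hgd
    have hE : ∀ c : ℝ, HasDerivAt (fun s => Real.exp (c * s)) (Real.exp (c * s) * (c * 1)) s :=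
      fun c => ((hasDerivAt_id s).const_mul c).exp
    have hφd := ((hE 1).mul (hfd.sub hgd)).sub ((hE 3).const_mul (2 / 3 * S))
    have hkey := (hf₁ s hs0).add_mfmRHS_sub_le (hg₁ s hs0) hJ0 hc hη
      (mul_nonneg hS (Real.exp_pos (2 * s)).le) (fun y => h y s hs0) x
    have hφ' : deriv φ s = _ := hφd.deriv
    rw [hφ']
    have h3 : Real.exp (3 * s) = Real.exp (1 * s) * Real.exp (2 * s) := by
      rw [← Real.exp_add]
      ring_nf
    rw [h3]
    have := mul_le_mul_of_nonneg_left hkey (Real.exp_pos (1 * s)).le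
    simp only [Pi.sub_apply]
    linarith
  have hφ0 : φ 0 ≤ ε := by
    simp only [φ, mul_zero, Real.exp_zero, one_mul, mul_one]
    linarith [h0 x]
  have h3 : Real.exp (3 * t) = Real.exp (1 * t) * Real.exp (2 * t) := by
    rw [← Real.exp_add]
    ring_nf
  have h1 : 1 ≤ Real.exp (2 * t) := Real.one_le_exp (by positivity)
  have h1' : 1 ≤ Real.exp (1 * t) := Real.one_le_exp (by positivity)
  have hφt : Real.exp (1 * t) * (f x t - g (x + δ) t) - 2 / 3 * S * Real.exp (3 * t) ≤ ε :=
    hmain.trans hφ0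
  rw [h3] at hφt
  have h4 : ε ≤ Real.exp (1 * t) * (ε * Real.exp (2 * t)) := by
    have h5 : ε * 1 ≤ ε * Real.exp (2 * t) := mul_le_mul_of_nonneg_left h1 hε
    nlinarith
  refine le_of_mul_le_mul_left ?_ (Real.exp_pos (1 * t))
  linarith

/-- Comparison principle for shifted mean-field models. -/
theorem IsMFM.sub_le [IsProbabilityMeasure J] (hJ0 : J (Iic 0) = 0)
    (hc : ContinuousOn η (Icc 0 1)) (hη : ∀ ν ∈ Icc (0 : ℝ) 1, η ν ∈ Icc (0 : ℝ) 1)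
    (hf : IsMFM η J f) (hg : IsMFM η J g) {δ ε : ℝ} (hε : 0 ≤ ε)
    (h0 : ∀ x, f x 0 - g (x + δ) 0 ≤ ε) (x t : ℝ) (ht : 0 ≤ t) :
    f x t - g (x + δ) t ≤ 3 * ε * Real.exp (2 * t) := by
  have hn : ∀ n : ℕ, ∀ x t, 0 ≤ t →
      f x t - g (x + δ) t ≤ (3 * ε + (2 / 3) ^ n) * Real.exp (2 * t) := by
    intro n
    induction n with
    | zero =>
      intro x t ht
      have h1 : 1 ≤ Real.exp (2 * t) := Real.one_le_exp (by positivity)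
      have := ((hf.1 t ht).le_one x)
      have := ((hg.1 t ht).nonneg (x + δ))
      nlinarith
    | succ n ih =>
      intro x t ht
      refine (IsMFM.sub_le_of_sub_le hJ0 hc hη hf hg hε (by positivity) h0 ih x t ht).trans
        (le_of_eq ?_)
      ring
  have hlim : Tendsto (fun n : ℕ => (3 * ε + (2 / 3 : ℝ) ^ n) * Real.exp (2 * t)) atTop
      (𝓝 ((3 * ε + 0) * Real.exp (2 * t))) :=
    ((_root_.tendsto_pow_atTop_nhds_zero_of_lt_one (by norm_num) (by norm_num)).const_add _).mul_const _
  rw [add_zero] at hlim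
  exact ge_of_tendsto' hlim fun n => hn n x t ht

end Comparison

section Theorems
open MeasureTheory Filter Set ENNReal NNReal

theorem mean_field_model_continuous_dependence_on_initial_condition
    (η : ℝ → ℝ)
    (hη_cont : ContinuousOn η (Set.Icc 0 1))
    (hη_anti : StrictAntiOn η (Set.Icc 0 1))
    (hη0 : η 0 = 1) (hη1 : η 1 = 0)
    (J : Measure ℝ) [IsProbabilityMeasure J]
    (hJ0 : J (Set.Iic 0) = 0)
    (hJmean : ∫ z, z ∂J = 1)
    (hJdens : DensityLowerBdd J)
    (fk : ℕ → ℝ → ℝ → ℝ) (f : ℝ → ℝ → ℝ)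
    (hk : ∀ k, IsMFM η J (fk k)) (hf : IsMFM η J f)
    (hweak : ∀ h : BoundedContinuousFunction ℝ ℝ,
      Filter.Tendsto (fun k => ∫ x, h x ∂(cdfMeasure (fun x => fk k x 0)))
        Filter.atTop (nhds (∫ x, h x ∂(cdfMeasure (fun x => f x 0))))) :
    ∀ T : ℝ, 0 < T →
      Filter.Tendsto
        (fun k => ⨆ t ∈ Set.Icc (0:ℝ) T,
          levyProkhorovDist (cdfMeasure (fun x => fk k x t)) (cdfMeasure (fun x => f x t)))
        Filter.atTop (nhds 0) := by
  have hη : ∀ ν ∈ Icc (0 : ℝ) 1, η ν ∈ Icc (0 : ℝ) 1 := fun ν hν =>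
    ⟨hη1 ▸ hη_anti.antitoneOn hν (right_mem_Icc.2 zero_le_one) hν.2,
      hη0 ▸ hη_anti.antitoneOn (left_mem_Icc.2 zero_le_one) hν hν.1⟩
  intro T hT
  refine Metric.tendsto_atTop'.2 fun ε' hε' => ?_
  obtain ⟨ε, hε, hεε'⟩ := exists_between hε'
  have hf0 := hf.1 0 le_rfl
  have hfT := hf.1 T hT.le
  obtain ⟨a, ha⟩ := (hf0.tendsto_atBot.eventually (gt_mem_nhds (show 0 < ε / 4 by linarith))).exists
  obtain ⟨b, hb⟩ :=
    (hfT.tendsto_atTop.eventually (lt_mem_nhds (show 1 - ε / 4 < 1 by linarith))).exists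
  obtain ⟨N, hN⟩ := exists_nat_ge ((b - a) / (ε / 2))
  rw [div_le_iff₀ (by linarith)] at hN
  obtain ⟨δ, hδ, hδε, hδN⟩ : ∃ δ : ℝ, 0 < δ ∧ δ ≤ ε / 2 ∧ 2 * (N + 1) * δ ≤ ε / 2 := by
    refine ⟨ε / (4 * (N + 1)), by positivity, ?_, le_of_eq (by field_simp; norm_num)⟩
    gcongr
    have : (0 : ℝ) ≤ N := N.cast_nonneg
    linarith
  have hE : 1 ≤ Real.exp (2 * T) := Real.one_le_exp (by positivity)
  obtain ⟨δ₀, hδ₀, hδ₀δ, hδ₀E⟩ :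
      ∃ δ₀ : ℝ, 0 < δ₀ ∧ δ₀ ≤ δ ∧ 3 * δ₀ * Real.exp (2 * T) = δ := by
    refine ⟨δ / (3 * Real.exp (2 * T)), by positivity, div_le_self hδ.le (by linarith), ?_⟩
    field_simp
  obtain ⟨K, hK⟩ := eventually_atTop.1
    (eventually_levy_of_weak (fun k => (hk k).1 0 le_rfl) hf0 hweak hδ₀)
  refine ⟨K, fun k hkK => ?_⟩
  obtain ⟨h₁, h₂⟩ := hK k (le_of_lt hkK)
  have hlevy : ∀ {p q : ℝ → ℝ → ℝ}, IsMFM η J p → IsMFM η J q →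
      (∀ x, p x 0 ≤ q (x + δ₀) 0 + δ₀) → ∀ t ∈ Icc 0 T, ∀ x, p x t ≤ q (x + δ) t + δ := by
    intro p q hp hq h t ht x
    have h3 := IsMFM.sub_le hJ0 hη_cont hη hp hq hδ₀.le
      (fun y => sub_le_iff_le_add'.2 (h y)) x t ht.1
    have h4 : 3 * δ₀ * Real.exp (2 * t) ≤ 3 * δ₀ * Real.exp (2 * T) := by
      gcongr
      exact ht.2
    have h5 : q (x + δ₀) t ≤ q (x + δ) t := (hq.1 t ht.1).mono (by linarith)
    linarith
  have hdist : ∀ t ∈ Icc 0 T,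
      levyProkhorovDist (cdfMeasure (fun x => fk k x t)) (cdfMeasure (fun x => f x t)) ≤ ε := by
    intro t ht
    refine levyProkhorovDist_le_of_levy (a := a) (h := ε / 2) (κ := ε / 4) (δ := δ) (N := N)
      ((hk k).1 t ht.1) (hf.1 t ht.1) (by linarith) hδ.le (by linarith) ?_ ?_
      (hlevy (hk k) hf h₁ t ht) (hlevy hf (hk k) h₂ t ht) (by linarith) (by linarith)
    · exact (hf.2.1 a self_mem_Ici ht.1 ht.1).trans ha.le
    · calc 1 - ε / 4 ≤ f b T := hb.le
        _ ≤ f b t := hf.2.1 b ht.1 hT.le ht.2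
        _ ≤ _ := (hf.1 t ht.1).mono (by linarith)
  have hle : ⨆ t ∈ Icc (0 : ℝ) T,
      levyProkhorovDist (cdfMeasure (fun x => fk k x t)) (cdfMeasure (fun x => f x t)) ≤ ε :=
    Real.iSup_le (fun t => Real.iSup_le (hdist t) hε.le) hε.le
  have hnn : 0 ≤ ⨆ t ∈ Icc (0 : ℝ) T,
      levyProkhorovDist (cdfMeasure (fun x => fk k x t)) (cdfMeasure (fun x => f x t)) :=
    Real.iSup_nonneg fun t => Real.iSup_nonneg fun _ => ENNReal.toReal_nonneg
  rw [Real.dist_eq, sub_zero, abs_of_nonneg hnn]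
  exact hle.trans_lt hεε'

end Theorems
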